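/- Let F : ℝ^p → ℝ be differentiable with ∇F L-Lipschitz, i.e., ‖∇F(u) − ∇F(v)‖ ≤ L‖u − v‖ for all u, v ∈ ℝ^p. Then for every w, z ∈ ℝ^p and η > 0, setting w⁺ = w − η z, we have F(w⁺) − F(w) ≤ −(η/2) ‖∇F(w)‖² + (η/2) ‖z − ∇F(w)‖² + max(0, (η² L − η)/2) · ‖z‖². -/

import Mathlib

/-- The descent inequality for a function with `L`-Lipschitz gradient. -/
theorem sub_le_inner_gradient_add_of_lipschitz_gradient {E : Type*} [NormedAddCommGroup E]
    [InnerProductSpace ℝ E] [CompleteSpace E] {F : E → ℝ} {L : ℝ} (hF : Differentiable ℝ F)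
    (hLip : ∀ u v, ‖gradient F u - gradient F v‖ ≤ L * ‖u - v‖) (u v : E) :
    F u - F v ≤ inner ℝ (gradient F v) (u - v) + L / 2 * ‖u - v‖ ^ 2 := by
  set d := u - v with hd
  have hline (t : ℝ) : HasDerivAt (fun t : ℝ => F (v + t • d))
      (inner ℝ (gradient F (v + t • d)) d) t := by
    have h : HasDerivAt (fun t : ℝ => v + t • d) d t := by
      simpa using ((hasDerivAt_id t).smul_const d).const_add v
    exact (hF (v + t • d)).hasGradientAt.hasFDerivAt.comp_hasDerivAt t h
  have hquad (t : ℝ) : HasDerivAt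
      (fun t : ℝ => F v + t * inner ℝ (gradient F v) d + L / 2 * ‖d‖ ^ 2 * t ^ 2)
      (inner ℝ (gradient F v) d + L * ‖d‖ ^ 2 * t) t := by
    exact ((((hasDerivAt_id t).mul_const (inner ℝ (gradient F v) d)).const_add (F v)).add
      ((hasDerivAt_pow 2 t).const_mul (L / 2 * ‖d‖ ^ 2))).congr_deriv (by push_cast; ring)
  have key := image_le_of_deriv_right_le_deriv_boundary (a := 0) (b := 1)
    (fun t _ => (hline t).continuousAt.continuousWithinAt)
    (fun t _ => (hline t).hasDerivWithinAt) (by simp)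
    (fun t _ => (hquad t).continuousAt.continuousWithinAt)
    (fun t _ => (hquad t).hasDerivWithinAt)
    (fun t ht => by
      have hip := real_inner_le_norm (gradient F (v + t • d) - gradient F v) d
      have hgrad := mul_le_mul_of_nonneg_right (hLip (v + t • d) v) (norm_nonneg d)
      rw [add_sub_cancel_left, norm_smul, Real.norm_of_nonneg ht.1] at hgrad
      rw [inner_sub_left] at hip
      linarith)
    (Set.right_mem_Icc.2 zero_le_one)
  simp only [one_smul, one_mul, one_pow, mul_one, hd, add_sub_cancel] at key
  rw [hd]
  linarith

theorem stmt_7 {p : ℕ} (F : EuclideanSpace ℝ (Fin p) → ℝ) (L : ℝ)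
    (hF : Differentiable ℝ F)
    (hLip : ∀ u v : EuclideanSpace ℝ (Fin p),
      ‖gradient F u - gradient F v‖ ≤ L * ‖u - v‖)
    (w z : EuclideanSpace ℝ (Fin p)) (η : ℝ) (hη : 0 < η) :
    F (w - η • z) - F w ≤ -(η / 2) * ‖gradient F w‖ ^ 2
      + (η / 2) * ‖z - gradient F w‖ ^ 2
      + max 0 ((η ^ 2 * L - η) / 2) * ‖z‖ ^ 2 := by
  have hdescent := sub_le_inner_gradient_add_of_lipschitz_gradient hF hLip (w - η • z) w
  rw [sub_sub_cancel_left, inner_neg_right, norm_neg, inner_smul_right, norm_smul,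
    Real.norm_of_nonneg hη.le] at hdescent
  have hmax := mul_le_mul_of_nonneg_right (le_max_right 0 ((η ^ 2 * L - η) / 2))
    (sq_nonneg ‖z‖)
  rw [norm_sub_sq_real, real_inner_comm]
  linarith
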